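/- Let k be a field, ⟨I,<⟩ a linearly ordered type, and for each i ∈ I let ⟨X_i,<_i⟩ be a linearly ordered type; order X := Σ i, X_i lexicographically. Let deg : X → ℕ satisfy deg(x) ≥ 1, let T be the splay algebra of the free commutative coordinate algebras k[X_i], filtered by T^(n) := the k-span of images of words of total degree ≤ n, and let π be a Poisson structure on T with internal symmetry (π vanishes on pairs of images of generators from the same block) and strongly filtered (π(T^(m),T^(n)) ⊆ T^(m+n−1)). Let J be the two-sided ideal of T generated by { f·g − g·f − π(f,g) : f,g ∈ T } and U := T/J. Then for every i ∈ I, the composite k-algebra homomorphism MvPolynomial X_i k → T → U (sending each variable x ∈ X_i to the image of the generator (i,x)) is injective; in particular each coordinate algebra MvPolynomial X_i k is a k-subalgebra of U. -/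

import Mathlib

noncomputable section

/-- Same-block commutation relation; its `RingQuot` is the splay algebra `T` of the
free commutative coordinate algebras `k[X i]`. -/
def splayRel (k : Type*) [CommRing k] {I : Type*} (X : I → Type*) :
    FreeAlgebra k (Σ i, X i) → FreeAlgebra k (Σ i, X i) → Prop := fun a b =>
  ∃ (i : I) (x y : X i),
    a = FreeAlgebra.ι k (⟨i, x⟩ : Σ i, X i) * FreeAlgebra.ι k (⟨i, y⟩ : Σ i, X i) ∧
    b = FreeAlgebra.ι k (⟨i, y⟩ : Σ i, X i) * FreeAlgebra.ι k (⟨i, x⟩ : Σ i, X i)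

/-- The splay algebra of the free commutative coordinate algebras `k[X i]`. -/
abbrev Splay (k : Type*) [CommRing k] {I : Type*} (X : I → Type*) : Type _ :=
  RingQuot (splayRel k X)

/-- The image in the splay algebra of the generator indexed by `x : Σ i, X i`. -/
def splayGen (k : Type*) [CommRing k] {I : Type*} (X : I → Type*) (x : Σ i, X i) :
    Splay k X :=
  RingQuot.mkAlgHom k (splayRel k X) (FreeAlgebra.ι k x)

/-- `T^(n)`: the `k`-span of the images of words of total `deg`-weighted degree `≤ n`. -/
def splayFil (k : Type*) [CommRing k] {I : Type*} (X : I → Type*)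
    (deg : (Σ i, X i) → ℕ) (n : ℕ) : Submodule k (Splay k X) :=
  Submodule.span k {t : Splay k X | ∃ w : List (Σ i, X i),
    (w.map deg).sum ≤ n ∧ t = (w.map (splayGen k X)).prod}

/-- A Poisson structure on an associative unital `k`-algebra `A`: a `k`-bilinear
biderivation which is skew-symmetric and satisfies the Jacobi identity. -/
def IsPoissonStructure {k A : Type*} [CommRing k] [Ring A] [Algebra k A]
    (π : A →ₗ[k] A →ₗ[k] A) : Prop :=
  (∀ a b c : A, π (a * b) c = a * π b c + π a c * b) ∧
  (∀ a b c : A, π a (b * c) = b * π a c + π a b * c) ∧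
  (∀ a b : A, π a b = - π b a) ∧
  (∀ a b c : A, π (π a b) c + π (π b c) a + π (π c a) b = 0)

/-- The relation whose `RingQuot` is `U := T/J`, with `J` the two-sided ideal of `T`
generated by `{f·g − g·f − π(f,g) : f, g ∈ T}`. -/
def poissonCommRel {k : Type*} [CommRing k] (A : Type*) [Ring A] [Algebra k A]
    (π : A →ₗ[k] A →ₗ[k] A) : A → A → Prop := fun a b =>
  ∃ f g : A, a = f * g ∧ b = g * f + π f g

section Biderivation

variable {k A : Type*} [CommRing k] [Ring A] [Algebra k A] {π : A →ₗ[k] A →ₗ[k] A}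

/-- Expanding `π (a * c) (b * d)` in two ways. -/
theorem IsPoissonStructure.commutator_mul (hπ : IsPoissonStructure π) (a b c d : A) :
    (a * b - b * a) * π c d = π a b * (c * d - d * c) := by
  obtain ⟨hl, hr, -, -⟩ := hπ
  have h1 : π (a * c) (b * d) =
      a * (b * π c d + π c b * d) + (b * π a d + π a b * d) * c := by rw [hl, hr, hr]
  have h2 : π (a * c) (b * d) =
      b * (a * π c d + π a d * c) + (a * π c b + π a b * c) * d := by rw [hr, hl, hl]
  rw [h1, ← sub_eq_zero] at h2
  rw [← sub_eq_zero, ← h2]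
  noncomm_ring

theorem IsPoissonStructure.commutator_mul_mul (hπ : IsPoissonStructure π) (a b u c d : A) :
    (a * b - b * a) * u * π c d = π a b * u * (c * d - d * c) := by
  have h1 := hπ.commutator_mul a b (u * c) d
  have h2 := hπ.commutator_mul a b u d
  rw [hπ.1] at h1
  calc (a * b - b * a) * u * π c d
      = (a * b - b * a) * (u * π c d + π u d * c) - (a * b - b * a) * π u d * c := by
        noncomm_ring
    _ = π a b * u * (c * d - d * c) := by
        rw [h1, h2]
        noncomm_ring

end Biderivation

section Splay

variable {k : Type*} [CommRing k] {I : Type*} {X : I → Type*}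

theorem splayGen_mul_comm (i : I) (x y : X i) :
    splayGen k X ⟨i, x⟩ * splayGen k X ⟨i, y⟩ = splayGen k X ⟨i, y⟩ * splayGen k X ⟨i, x⟩ := by
  simp only [splayGen, ← map_mul]
  exact RingQuot.mkAlgHom_rel k ⟨i, x, y, rfl, rfl⟩

theorem adjoin_range_splayGen : Algebra.adjoin k (Set.range (splayGen k X)) = ⊤ := by
  have h : Set.range (splayGen k X) =
      RingQuot.mkAlgHom k (splayRel k X) '' Set.range (FreeAlgebra.ι k) := by
    rw [← Set.range_comp]
    rfl
  rw [h, ← AlgHom.map_adjoin, FreeAlgebra.adjoin_range_ι, Algebra.map_top,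
    AlgHom.range_eq_top]
  exact RingQuot.mkAlgHom_surjective k (splayRel k X)

theorem Splay.induction {p : Splay k X → Prop} (gen : ∀ x, p (splayGen k X x))
    (algebraMap : ∀ r, p (algebraMap k (Splay k X) r))
    (add : ∀ a b, p a → p b → p (a + b)) (mul : ∀ a b, p a → p b → p (a * b))
    (a : Splay k X) : p a := by
  have ha : a ∈ Algebra.adjoin k (Set.range (splayGen k X)) := by
    rw [adjoin_range_splayGen]
    trivial
  induction ha using Algebra.adjoin_induction with
  | mem x hx => obtain ⟨y, rfl⟩ := hx; exact gen y
  | algebraMap r => exact algebraMap r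
  | add a b _ _ ha hb => exact add a b ha hb
  | mul a b _ _ ha hb => exact mul a b ha hb

/-- The universal property of the splay algebra. -/
def Splay.lift {B : Type*} [Ring B] [Algebra k B] (f : (Σ i, X i) → B)
    (hf : ∀ (i : I) (x y : X i), f ⟨i, x⟩ * f ⟨i, y⟩ = f ⟨i, y⟩ * f ⟨i, x⟩) :
    Splay k X →ₐ[k] B :=
  RingQuot.liftAlgHom k ⟨FreeAlgebra.lift k f, by
    rintro _ _ ⟨i, x, y, rfl, rfl⟩
    simpa using hf i x y⟩

theorem Splay.lift_gen {B : Type*} [Ring B] [Algebra k B] (f : (Σ i, X i) → B)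
    (hf : ∀ (i : I) (x y : X i), f ⟨i, x⟩ * f ⟨i, y⟩ = f ⟨i, y⟩ * f ⟨i, x⟩) (x : Σ i, X i) :
    Splay.lift f hf (splayGen k X x) = f x := by
  simp [Splay.lift, splayGen]

variable (k X) in
/-- The abelianization of the splay algebra. -/
def Splay.toMvPolynomial : Splay k X →ₐ[k] MvPolynomial (Σ i, X i) k :=
  Splay.lift MvPolynomial.X fun _ _ _ => mul_comm _ _

theorem Splay.toMvPolynomial_gen (x : Σ i, X i) :
    Splay.toMvPolynomial k X (splayGen k X x) = MvPolynomial.X x :=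
  Splay.lift_gen _ _ x

open Classical in
variable (k X) in
/-- An upper triangular representation of the splay algebra, with the abelianization as upper left
entry, in which a generator of the block `i` commutes with no generator of another block. -/
def Splay.toMatrix (i : I) :
    Splay k X →ₐ[k] Matrix (Fin 2) (Fin 2) (MvPolynomial (Σ i, X i) k) :=
  Splay.lift (fun x => !![MvPolynomial.X x, if x.1 = i then MvPolynomial.X x else 0; 0, 0])
    fun j x y => by
      by_cases h : j = i <;> simp [h, mul_comm]

theorem Splay.toMatrix_entries (i : I) (a : Splay k X) :
    Splay.toMatrix k X i a 1 0 = 0 ∧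
      Splay.toMatrix k X i a 0 0 = Splay.toMvPolynomial k X a := by
  induction a using Splay.induction with
  | gen x => simp [Splay.toMatrix, Splay.toMvPolynomial, Splay.lift_gen]
  | algebraMap r =>
    rw [AlgHom.commutes, AlgHom.commutes]
    simp [Matrix.algebraMap_matrix_apply]
  | add a b ha hb => simp [ha, hb]
  | mul a b ha hb => simp [Matrix.mul_apply, ha, hb]

theorem IsPoissonStructure.toMvPolynomial_gen_eq_zero [IsDomain k]
    {π : Splay k X →ₗ[k] Splay k X →ₗ[k] Splay k X} (hπ : IsPoissonStructure π)
    {x y : Σ i, X i} (hxy : x.1 ≠ y.1) :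
    Splay.toMvPolynomial k X (π (splayGen k X x) (splayGen k X y)) = 0 := by
  have h := hπ.commutator_mul_mul (splayGen k X x) (splayGen k X y) (splayGen k X x)
    (splayGen k X x) (splayGen k X y)
  have h' := congrArg (fun a => Splay.toMatrix k X x.1 a 0 1) h
  have hx : Splay.toMatrix k X x.1 (splayGen k X x) =
      !![MvPolynomial.X x, MvPolynomial.X x; 0, 0] := by
    simp [Splay.toMatrix, Splay.lift_gen]
  have hy : Splay.toMatrix k X x.1 (splayGen k X y) = !![MvPolynomial.X y, 0; 0, 0] := by
    simp [Splay.toMatrix, Splay.lift_gen, hxy.symm]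
  simpa [hx, hy, Matrix.mul_apply, (Splay.toMatrix_entries x.1 _).2, mul_comm,
    MvPolynomial.X_ne_zero] using h'

theorem IsPoissonStructure.toMvPolynomial_eq_zero [IsDomain k]
    {π : Splay k X →ₗ[k] Splay k X →ₗ[k] Splay k X} (hπ : IsPoissonStructure π)
    (hsym : ∀ (i : I) (x y : X i), π (splayGen k X ⟨i, x⟩) (splayGen k X ⟨i, y⟩) = 0)
    (a b : Splay k X) : Splay.toMvPolynomial k X (π a b) = 0 := by
  have one_left (c : Splay k X) : π 1 c = 0 := by simpa using hπ.1 1 1 c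
  have one_right (c : Splay k X) : π c 1 = 0 := by simpa using hπ.2.1 c 1 1
  induction a using Splay.induction with
  | gen x =>
    induction b using Splay.induction with
    | gen y =>
      by_cases h : x.1 = y.1
      · obtain ⟨i, x⟩ := x
        obtain ⟨j, y⟩ := y
        obtain rfl : i = j := h
        rw [hsym, map_zero]
      · exact hπ.toMvPolynomial_gen_eq_zero h
    | algebraMap r => simp [Algebra.algebraMap_eq_smul_one, one_right]
    | add b c hb hc => simp [hb, hc]
    | mul b c hb hc => simp [hπ.2.1, hb, hc]
  | algebraMap r => simp [Algebra.algebraMap_eq_smul_one, one_left]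
  | add a c ha hc => simp [ha, hc]
  | mul a c ha hc => simp [hπ.1, ha, hc]

open scoped IsMulCommutative in
/-- The inclusion of the `i`-th coordinate algebra in the splay algebra. -/
theorem Splay.exists_ofBlock (i : I) : ∃ φ : MvPolynomial (X i) k →ₐ[k] Splay k X,
    ∀ x, φ (MvPolynomial.X x) = splayGen k X ⟨i, x⟩ := by
  let s : Set (Splay k X) := Set.range fun x : X i => splayGen k X ⟨i, x⟩
  have : IsMulCommutative (Algebra.adjoin k s) := Algebra.isMulCommutative_adjoin k (by
    rintro _ ⟨x, rfl⟩ _ ⟨y, rfl⟩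
    exact splayGen_mul_comm i x y)
  let g (x : X i) : Algebra.adjoin k s := ⟨_, Algebra.subset_adjoin ⟨x, rfl⟩⟩
  refine ⟨(Algebra.adjoin k s).val.comp (MvPolynomial.aeval g), fun x => ?_⟩
  simp [g]

end Splay

/-- In the setting of the splay PBW theorem, for each `i` the composite
`k`-algebra homomorphism `MvPolynomial (X i) k → T → U` sending each variable `x` to
the image of the generator `(i,x)` is injective; in particular each coordinate algebra
is a `k`-subalgebra of `U`. -/
theorem coordinate_algebras_embed_in_U
    (k : Type*) [Field k] (I : Type*) [LinearOrder I]
    (X : I → Type*) [∀ i, LinearOrder (X i)]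
    (deg : (Σ i, X i) → ℕ) (hdeg : ∀ x, 1 ≤ deg x)
    (π : Splay k X →ₗ[k] Splay k X →ₗ[k] Splay k X)
    (hπ : IsPoissonStructure π)
    (hsym : ∀ (i : I) (x y : X i), π (splayGen k X ⟨i, x⟩) (splayGen k X ⟨i, y⟩) = 0)
    (hfilt : ∀ m n : ℕ, ∀ a ∈ splayFil k X deg m, ∀ b ∈ splayFil k X deg n,
      π a b ∈ splayFil k X deg (m + n - 1)) :
    ∀ i : I, ∃ φ : MvPolynomial (X i) k →ₐ[k] RingQuot (poissonCommRel (Splay k X) π),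
      (∀ x : X i, φ (MvPolynomial.X x) =
        RingQuot.mkAlgHom k (poissonCommRel (Splay k X) π) (splayGen k X ⟨i, x⟩)) ∧
      Function.Injective φ := by
  intro i
  obtain ⟨φ, hφ⟩ := Splay.exists_ofBlock (k := k) (X := X) i
  let ψ : RingQuot (poissonCommRel (Splay k X) π) →ₐ[k] MvPolynomial (Σ i, X i) k :=
    RingQuot.liftAlgHom k ⟨Splay.toMvPolynomial k X, by
      rintro _ _ ⟨f, g, rfl, rfl⟩
      rw [map_add, map_mul, map_mul, hπ.toMvPolynomial_eq_zero hsym, add_zero, mul_comm]⟩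
  let Φ := (RingQuot.mkAlgHom k (poissonCommRel (Splay k X) π)).comp φ
  refine ⟨Φ, fun x => by simp [Φ, hφ], ?_⟩
  have hψ : ψ.comp Φ = MvPolynomial.rename (Sigma.mk i) := by
    ext1 x
    simp [ψ, Φ, hφ, Splay.toMvPolynomial_gen]
  refine Function.Injective.of_comp (f := ψ) ?_
  rw [← AlgHom.coe_comp, hψ]
  exact MvPolynomial.rename_injective _ sigma_mk_injective

end
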